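/- Assume K is convex. If SOL^w(K_∞, f^∞) = {0}, then the weak vector complementarity problem WVCP(K_∞, ∇f^∞) is of type R_0, i.e., x = 0 is the only point x ∈ K_∞ satisfying: (⟨∇f_1^∞(x), y⟩, …, ⟨∇f_s^∞(x), y⟩) ∉ −int ℝ^s_+ for every y ∈ K_∞, and (⟨∇f_1^∞(x), x⟩, …, ⟨∇f_s^∞(x), x⟩) ∉ int ℝ^s_+. -/

import Mathlib

open Filter Topology MvPolynomial

/-- The asymptotic cone of a set `K ⊆ ℝⁿ`:
`K_∞ = {v : ∃ t_k → +∞, x_k ∈ K with x_k / t_k → v}`. -/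
def asympCone {n : ℕ} (K : Set (Fin n → ℝ)) : Set (Fin n → ℝ) :=
  {v | ∃ (t : ℕ → ℝ) (x : ℕ → (Fin n → ℝ)), (∀ k, x k ∈ K) ∧
    Tendsto t atTop atTop ∧ Tendsto (fun k => (t k)⁻¹ • x k) atTop (nhds v)}

/-- The weak Pareto efficient solution set of the vector function `p` on `C`:
`x* ∈ C` such that for no `x ∈ C` we have `p(x) - p(x*) ∈ -int ℝˢ₊`. -/
def SOLw {n s : ℕ} (C : Set (Fin n → ℝ)) (p : Fin s → (Fin n → ℝ) → ℝ) : Set (Fin n → ℝ) :=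
  {x | x ∈ C ∧ ∀ y ∈ C, ¬ (∀ i, p i y < p i x)}

/-- The Pareto efficient solution set of the vector function `p` on `C`:
`x* ∈ C` such that for no `x ∈ C` we have `p(x) - p(x*) ∈ -ℝˢ₊ \ {0}`. -/
def SOLs {n s : ℕ} (C : Set (Fin n → ℝ)) (p : Fin s → (Fin n → ℝ) → ℝ) : Set (Fin n → ℝ) :=
  {x | x ∈ C ∧ ∀ y ∈ C, ¬ ((∀ i, p i y ≤ p i x) ∧ (∃ i, p i y < p i x))}

/-- The set of global minimizers of the scalar function `q` on `C`. -/
def SOLmin {n : ℕ} (C : Set (Fin n → ℝ)) (q : (Fin n → ℝ) → ℝ) : Set (Fin n → ℝ) :=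
  {x | x ∈ C ∧ ∀ y ∈ C, q x ≤ q y}

/-- The recession polynomial (vector leading term) of `p`, as a function:
`p^∞(x) = lim_{λ→+∞} p(λx)/λ^{deg p}`, i.e. the evaluation of the homogeneous
component of `p` of top degree. -/
noncomputable def recFn {n : ℕ} (p : MvPolynomial (Fin n) ℝ) : (Fin n → ℝ) → ℝ :=
  fun x => eval x (homogeneousComponent p.totalDegree p)

/-- Evaluation of a polynomial, as a function `ℝⁿ → ℝ`. -/
noncomputable def evalFn {n : ℕ} (p : MvPolynomial (Fin n) ℝ) : (Fin n → ℝ) → ℝ :=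
  fun x => eval x p

/-- `⟨∇p^∞(x), y⟩`: the inner product of the gradient of the recession polynomial
of `p` at `x` with `y`. -/
noncomputable def gradRecInner {n : ℕ} (p : MvPolynomial (Fin n) ℝ) (x y : Fin n → ℝ) : ℝ :=
  ∑ j, (eval x (pderiv j (homogeneousComponent p.totalDegree p))) * y j

/-- `x` is a solution of the weak vector complementarity problem
`WVCP(C, ∇f^∞)`. -/
def isWVCPsol {n s : ℕ} (C : Set (Fin n → ℝ)) (f : Fin s → MvPolynomial (Fin n) ℝ)
    (x : Fin n → ℝ) : Prop :=
  x ∈ C ∧ (∀ y ∈ C, ¬ (∀ i, gradRecInner (f i) x y < 0)) ∧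
    ¬ (∀ i, 0 < gradRecInner (f i) x x)

theorem eval_smul_homog {n m : ℕ} {p : MvPolynomial (Fin n) ℝ} (hp : p.IsHomogeneous m)
    (c : ℝ) (x : Fin n → ℝ) : eval (c • x) p = c ^ m * eval x p := by
  rw [eval_eq', eval_eq', Finset.mul_sum]
  refine Finset.sum_congr rfl fun d hd => ?_
  have h1 : ∑ i, d i = m := by
    have := hp.degree_eq_sum_deg_support hd
    rw [this]
    exact (Finset.sum_subset (Finset.subset_univ _) fun i _ hi => Finsupp.notMem_support_iff.1 hi).symm
  simp only [Pi.smul_apply, smul_eq_mul, mul_pow, Finset.prod_mul_distrib]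
  rw [Finset.prod_pow_eq_pow_sum, h1]
  ring

theorem recFn_smul {n : ℕ} (p : MvPolynomial (Fin n) ℝ) (c : ℝ) (x : Fin n → ℝ) :
    recFn p (c • x) = c ^ p.totalDegree * recFn p x :=
  eval_smul_homog (homogeneousComponent_isHomogeneous _ _) c x

theorem recFn_zero {n : ℕ} (p : MvPolynomial (Fin n) ℝ) (hp : 1 ≤ p.totalDegree) :
    recFn p 0 = 0 := by
  have := recFn_smul p 0 0
  rw [zero_smul, zero_pow (by omega), zero_mul] at this
  exact this

theorem continuous_recFn {n : ℕ} (p : MvPolynomial (Fin n) ℝ) : Continuous (recFn p) :=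
  MvPolynomial.continuous_eval _

theorem gradRecInner_self {n : ℕ} (p : MvPolynomial (Fin n) ℝ) (x : Fin n → ℝ) :
    gradRecInner p x x = p.totalDegree * recFn p x := by
  have h := (homogeneousComponent_isHomogeneous p.totalDegree p).sum_X_mul_pderiv
  have h2 := congrArg (eval x) h
  simp only [map_sum, map_mul, eval_X, nsmul_eq_mul, map_natCast] at h2
  rw [gradRecInner, recFn, ← h2]
  exact Finset.sum_congr rfl fun _ _ => mul_comm _ _

theorem gradRecInner_zero {n : ℕ} (p : MvPolynomial (Fin n) ℝ) (hp : 1 ≤ p.totalDegree)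
    (y : Fin n → ℝ) (hy : gradRecInner p 0 y < 0) : recFn p y < 0 := by
  have hh : ∀ j (c : ℝ) (z : Fin n → ℝ), _ := fun j c z => eval_smul_homog
    ((homogeneousComponent_isHomogeneous p.totalDegree p).pderiv (i := j)) c z
  by_cases h1 : p.totalDegree = 1
  · have : gradRecInner p 0 y = gradRecInner p y y := by
      refine Finset.sum_congr rfl fun j _ => ?_
      have := hh j 0 y
      rw [zero_smul, h1] at this
      rw [h1, this]; simp
    rw [this, gradRecInner_self, h1] at hy
    simpa using hy
  · exfalso
    have : gradRecInner p 0 y = 0 := by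
      refine Finset.sum_eq_zero fun j _ => ?_
      have := hh j 0 y
      rw [zero_smul, zero_pow (by omega)] at this
      rw [this]; simp
    linarith

theorem asympCone_smul {n : ℕ} {K : Set (Fin n → ℝ)} {v : Fin n → ℝ} (hv : v ∈ asympCone K)
    {c : ℝ} (hc : 0 < c) : c • v ∈ asympCone K := by
  obtain ⟨t, x, hx, ht, hl⟩ := hv
  refine ⟨fun k => c⁻¹ * t k, x, hx, ht.const_mul_atTop (inv_pos.2 hc), ?_⟩
  have := hl.const_smul c
  refine this.congr fun k => ?_
  rw [smul_smul, mul_inv, inv_inv]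

theorem isClosed_asympCone {n : ℕ} (K : Set (Fin n → ℝ)) : IsClosed (asympCone K) := by
  rw [← closure_subset_iff_isClosed]
  intro v hv
  have key : ∀ k : ℕ, ∃ (t : ℝ) (x : Fin n → ℝ), x ∈ K ∧ (k : ℝ) ≤ t ∧
      dist (t⁻¹ • x) v ≤ 1 / ((k : ℝ) + 1) := by
    intro k
    have hε : (0 : ℝ) < 1 / ((k : ℝ) + 1) / 2 := by positivity
    obtain ⟨w, ⟨t, x, hx, ht, hl⟩, hw⟩ := Metric.mem_closure_iff.1 hv _ hε
    obtain ⟨j, h1, h2⟩ := ((ht.eventually_ge_atTop (k : ℝ)).and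
      (Metric.tendsto_nhds.1 hl _ hε)).exists
    refine ⟨t j, x j, hx j, h1, ?_⟩
    have := dist_triangle ((t j)⁻¹ • x j) w v
    rw [dist_comm w v] at this
    linarith
  choose t x hx ht hd using key
  refine ⟨t, x, hx, tendsto_atTop_mono ht tendsto_natCast_atTop_atTop, ?_⟩
  rw [tendsto_iff_dist_tendsto_zero]
  exact squeeze_zero (fun _ => dist_nonneg) hd tendsto_one_div_add_atTop_nhds_zero_nat

/-- Every point is dominated by some weakly efficient point, which must be `0`. -/
theorem recFn_nonneg_of_SOLw {n s : ℕ} (hs : 0 < s) (K : Set (Fin n → ℝ))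
    (f : Fin s → MvPolynomial (Fin n) ℝ) (hdeg : ∀ i, 1 ≤ (f i).totalDegree)
    (h : SOLw (asympCone K) (fun i => recFn (f i)) = {0}) (y : Fin n → ℝ)
    (hy : y ∈ asympCone K) (i : Fin s) : 0 ≤ recFn (f i) y := by
  have h0 : (0 : Fin n → ℝ) ∈ SOLw (asympCone K) (fun i => recFn (f i)) := by rw [h]; rfl
  have hpos : ∀ v ∈ asympCone K, v ≠ 0 → ∃ i, 0 < recFn (f i) v := by
    intro v hv hv0
    by_contra hcon
    push Not at hcon
    have hvn : v ∉ SOLw (asympCone K) (fun i => recFn (f i)) := by rw [h]; exact hv0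
    apply hvn
    refine ⟨hv, fun w hw hlt => h0.2 w hw fun i => ?_⟩
    have h1 := recFn_zero (f i) (hdeg i)
    have h2 := hlt i
    have h3 := hcon i
    simp only at h2 ⊢
    linarith
  set g : (Fin n → ℝ) → ℝ := fun v => ∑ i, max (recFn (f i) v) 0 with hg
  have hgc : Continuous g :=
    continuous_finsetSum _ fun i _ => (continuous_recFn (f i)).max continuous_const
  have hm : ∃ m : ℝ, 0 < m ∧ ∀ v ∈ asympCone K, ‖v‖ = 1 → m ≤ g v := by
    have hcomp : IsCompact (asympCone K ∩ Metric.sphere 0 1) :=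
      (isCompact_sphere _ _).inter_left (isClosed_asympCone K)
    rcases (asympCone K ∩ Metric.sphere 0 1).eq_empty_or_nonempty with he | hne
    · refine ⟨1, one_pos, fun v hv hn => ?_⟩
      have : v ∈ asympCone K ∩ Metric.sphere 0 1 := ⟨hv, by simpa using hn⟩
      rw [he] at this
      exact this.elim
    · obtain ⟨v, hv, hmin⟩ := hcomp.exists_isMinOn hne hgc.continuousOn
      refine ⟨g v, ?_, fun w hw hn => hmin ⟨hw, by simpa using hn⟩⟩
      have hv1 : ‖v‖ = 1 := by simpa using hv.2
      obtain ⟨i, hi⟩ := hpos v hv.1 (by rintro rfl; simp at hv1)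
      exact Finset.sum_pos' (fun _ _ => le_max_right _ _)
        ⟨i, Finset.mem_univ _, lt_max_of_lt_left hi⟩
  obtain ⟨m, hm0, hm⟩ := hm
  set L : Set (Fin n → ℝ) := asympCone K ∩ ⋂ i, {u | recFn (f i) u ≤ recFn (f i) y} with hL
  have hLc : IsClosed L := (isClosed_asympCone K).inter
    (isClosed_iInter fun i => isClosed_le (continuous_recFn _) continuous_const)
  set M : ℝ := ∑ i, |recFn (f i) y| with hM
  have hM0 : 0 ≤ M := Finset.sum_nonneg fun _ _ => abs_nonneg _
  have hLb : L ⊆ Metric.closedBall 0 (max 1 (M / m)) := by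
    rintro u ⟨huC, hu⟩
    rw [mem_closedBall_zero_iff]
    by_contra hcon
    push Not at hcon
    have hu1 : 1 < ‖u‖ := lt_of_le_of_lt (le_max_left _ _) hcon
    have hu2 : M / m < ‖u‖ := lt_of_le_of_lt (le_max_right _ _) hcon
    have hup : 0 < ‖u‖ := by linarith
    have h1 := hm (‖u‖⁻¹ • u) (asympCone_smul huC (inv_pos.2 hup))
      (by rw [norm_smul, norm_inv, norm_norm, inv_mul_cancel₀ hup.ne'])
    have h2 : g (‖u‖⁻¹ • u) ≤ ‖u‖⁻¹ * M := by
      rw [hM, Finset.mul_sum]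
      refine Finset.sum_le_sum fun i _ => max_le ?_ (by positivity)
      rw [recFn_smul]
      have h3 : recFn (f i) u ≤ |recFn (f i) y| := (Set.mem_iInter.1 hu i).trans (le_abs_self _)
      have h4 : ‖u‖⁻¹ ^ (f i).totalDegree ≤ ‖u‖⁻¹ :=
        pow_le_of_le_one (by positivity) (inv_le_one_of_one_le₀ hu1.le)
          (by have := hdeg i; omega)
      calc _ ≤ ‖u‖⁻¹ ^ (f i).totalDegree * |recFn (f i) y| := by gcongr
        _ ≤ _ := by gcongr
    have h3 : m ≤ ‖u‖⁻¹ * M := h1.trans h2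
    rw [div_lt_iff₀ hm0] at hu2
    rw [inv_mul_eq_div, le_div_iff₀ hup] at h3
    linarith
  have hLk : IsCompact L := (isCompact_closedBall _ _).of_isClosed_subset hLc hLb
  have hyL : y ∈ L := ⟨hy, Set.mem_iInter.2 fun i => le_refl (recFn (f i) y)⟩
  obtain ⟨z, hz, hmin⟩ := hLk.exists_isMinOn ⟨y, hyL⟩
    (continuous_finsetSum Finset.univ fun i _ => continuous_recFn (f i)).continuousOn
  have hzs : z ∈ SOLw (asympCone K) (fun i => recFn (f i)) := by
    refine ⟨hz.1, fun w hw hlt => ?_⟩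
    have hwL : w ∈ L := ⟨hw, Set.mem_iInter.2 fun i =>
      (hlt i).le.trans (Set.mem_iInter.1 hz.2 i)⟩
    have h1 := isMinOn_iff.1 hmin w hwL
    have h2 : ∑ i, recFn (f i) w < ∑ i, recFn (f i) z :=
      Finset.sum_lt_sum_of_nonempty ⟨⟨0, hs⟩, Finset.mem_univ _⟩ fun i _ => hlt i
    linarith
  rw [h] at hzs
  have hz0 : z = 0 := hzs
  have := Set.mem_iInter.1 hz.2 i
  rw [hz0] at this
  have h5 : recFn (f i) 0 ≤ recFn (f i) y := this
  rwa [recFn_zero _ (hdeg i)] at h5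

theorem stmt7 {n s : ℕ} (hs : 0 < s) (K : Set (Fin n → ℝ)) (hK : K.Nonempty) (hKc : IsClosed K)
    (f : Fin s → MvPolynomial (Fin n) ℝ) (hdeg : ∀ i, 1 ≤ (f i).totalDegree) (hconv : Convex ℝ K)
    (h : SOLw (asympCone K) (fun i => recFn (f i)) = {0}) :
    {x | isWVCPsol (asympCone K) f x} = {0} := by
  have h0 : (0 : Fin n → ℝ) ∈ SOLw (asympCone K) (fun i => recFn (f i)) := by rw [h]; rfl
  ext x
  constructor
  · rintro ⟨hx, -, hx2⟩
    by_contra hx0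
    have hxn : x ∉ SOLw (asympCone K) (fun i => recFn (f i)) := by rw [h]; exact hx0
    apply hxn
    refine ⟨hx, fun y hy hlt => hx2 fun i => ?_⟩
    rw [gradRecInner_self]
    have h1 := recFn_nonneg_of_SOLw hs K f hdeg h y hy i
    have h2 : recFn (f i) y < recFn (f i) x := hlt i
    have h3 : (0 : ℝ) < (f i).totalDegree := by exact_mod_cast hdeg i
    exact mul_pos h3 (by linarith)
  · rintro rfl
    refine ⟨h0.1, fun y hy hlt => h0.2 y hy fun i => ?_, fun hlt => ?_⟩
    · have := gradRecInner_zero (f i) (hdeg i) y (hlt i)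
      simpa only [recFn_zero (f i) (hdeg i)] using this
    · have := hlt ⟨0, hs⟩
      rw [gradRecInner_self, recFn_zero _ (hdeg _)] at this
      simp at this
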